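/- Let a, b, c, d ∈ K̂ with |ad − bc|_∞ = 1 and let γ : f ↦ (af+b)/(cf+d) be the associated homography. The measure M on {(ξ₋, ξ₊) ∈ K̂ × K̂ : ξ₋ ≠ ξ₊} defined by dM(ξ₋,ξ₊) = dμ(ξ₋) dμ(ξ₊)/|ξ₊ − ξ₋|²_∞ is invariant under the almost-everywhere defined diagonal action (ξ₋, ξ₊) ↦ (γ·ξ₋, γ·ξ₊). In particular M is invariant under the diagonal action by homographies of every matrix in GL₂(A) with determinant in k∖{0}. -/

import Mathlib

open MeasureTheory
open scoped ENNReal Classical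

noncomputable section

namespace ArtinCoding

variable (k : Type*) [Field k] [Fintype k]

/-- The field `K̂ = k((X⁻¹))` of formal Laurent series in `X⁻¹` over `k`, realized as the
field of formal Laurent series `k((t))` in the variable `t = X⁻¹`. -/
abbrev Khat := LaurentSeries k

variable {k}

/-- The absolute value `|f|_∞ = q^{-v_∞(f)}`, where `v_∞` is the order of vanishing in the
variable `t = X⁻¹` (so a nonzero polynomial in `X` has absolute value `≥ 1`). -/
def absInf (f : Khat k) : ℝ :=
  if f = 0 then 0 else (Fintype.card k : ℝ) ^ (-f.order)

lemma absInf_nonneg (f : Khat k) : 0 ≤ absInf f := by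
  unfold absInf
  split
  · exact le_refl 0
  · positivity

lemma absInf_eq_zero {f : Khat k} : absInf f = 0 ↔ f = 0 := by
  constructor
  · intro h
    by_contra hf
    have hq : (0:ℝ) < (Fintype.card k : ℝ) := by
      have := Fintype.card_pos (α := k); positivity
    rw [absInf, if_neg hf] at h
    exact absurd h (ne_of_gt (zpow_pos hq _))
  · intro h; simp [absInf, h]

lemma absInf_neg (f : Khat k) : absInf (-f) = absInf f := by
  unfold absInf
  rw [neg_eq_zero, HahnSeries.order_neg]

lemma absInf_add_le (f g : Khat k) : absInf (f + g) ≤ max (absInf f) (absInf g) := by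
  rcases eq_or_ne (f + g) 0 with h | h
  · rw [show absInf (f+g) = 0 by rw [absInf_eq_zero]; exact h]
    exact le_max_of_le_left (absInf_nonneg f)
  rcases eq_or_ne f 0 with hf | hf
  · simp [hf]
  rcases eq_or_ne g 0 with hg | hg
  · simp [hg]
  have hmin := HahnSeries.min_order_le_order_add h
  have hq : (1:ℝ) ≤ (Fintype.card k : ℝ) := by
    exact_mod_cast Nat.one_le_iff_ne_zero.mpr Fintype.card_ne_zero
  rw [absInf, if_neg h]
  rcases le_total f.order g.order with hod | hod
  · rw [min_eq_left hod] at hmin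
    refine le_max_of_le_left ?_
    rw [absInf, if_neg hf]
    exact zpow_le_zpow_right₀ hq (neg_le_neg hmin)
  · rw [min_eq_right hod] at hmin
    refine le_max_of_le_right ?_
    rw [absInf, if_neg hg]
    exact zpow_le_zpow_right₀ hq (neg_le_neg hmin)

/-- The metric `d_∞(f,g) = |f-g|_∞` on `K̂`. -/
noncomputable instance : MetricSpace (Khat k) where
  dist f g := absInf (f - g)
  dist_self f := by simp [absInf]
  dist_comm f g := by
    have : g - f = -(f - g) := by ring
    show absInf (f - g) = absInf (g - f)
    rw [this, absInf_neg]
  dist_triangle f g h := by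
    show absInf (f - h) ≤ absInf (f - g) + absInf (g - h)
    have key : absInf (f - h) ≤ max (absInf (f - g)) (absInf (g - h)) := by
      have : f - h = (f - g) + (g - h) := by ring
      rw [this]; exact absInf_add_le _ _
    exact key.trans (max_le_add_of_nonneg (absInf_nonneg _) (absInf_nonneg _))
  eq_of_dist_eq_zero := by
    intro f g h
    have : f - g = 0 := absInf_eq_zero.mp h
    exact sub_eq_zero.mp this

/- Make sure the topology coming from the metric `d_∞` is the one used everywhere
(the valued-field uniformity on Laurent series induces the same topology). -/
instance (priority := 10000) : UniformSpace (Khat k) := PseudoMetricSpace.toUniformSpace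
instance (priority := 10000) : TopologicalSpace (Khat k) := UniformSpace.toTopologicalSpace

instance : MeasurableSpace (Khat k) := borel _
instance : BorelSpace (Khat k) := ⟨rfl⟩

variable (k)

/-- The element `X⁻¹` of `K̂` (the uniformizer `t`). -/
def Xinv : Khat k := HahnSeries.single (1 : ℤ) (1 : k)

/-- The element `X` of `K̂`. -/
def Xel : Khat k := HahnSeries.single (-1 : ℤ) (1 : k)

/-- The valuation ring `O = k[[X⁻¹]] = {f : |f|_∞ ≤ 1}`. -/
def Oball : Set (Khat k) := {f | absInf f ≤ 1}

/-- The set `X⁻¹O`, i.e. the maximal ideal of `O`. -/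
def XinvO : Set (Khat k) := (fun f => Xinv k * f) '' Oball k

/-- The ring `A = k[X]` of polynomials in `X`, viewed as a subset of `K̂`. -/
def Aset : Set (Khat k) := Set.range fun p : Polynomial k => Polynomial.aeval (Xel k) p

/-- The constants `k ⊆ K̂`. -/
def kconsts : Set (Khat k) := Set.range (algebraMap k (Khat k))

/-- The set `A∖k` of nonconstant polynomials in `X`, viewed inside `K̂`. -/
def AmK : Set (Khat k) := Aset k \ kconsts k

/-- The field `K = k(X)` of rational functions, viewed as a subset of `K̂`
(note that `k(X) = k(X⁻¹)` as a subfield of `K̂`). -/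
def Kset : Set (Khat k) := Set.range fun r : RatFunc k => (r : LaurentSeries k)

/-- The set `ᶜK = K̂ ∖ K` of irrational elements. -/
def cK : Set (Khat k) := (Kset k)ᶜ

variable {k}

/-- The integer part `[f] ∈ A = k[X]` of `f ∈ K̂`: the sum of the terms of `f` with
nonpositive exponents in `t = X⁻¹`. -/
def intPart (f : Khat k) : Khat k :=
  ∑ i ∈ Finset.Icc (min f.order 0) 0, HahnSeries.single i (f.coeff i)

/-- The fractional part `{f} = f - [f] ∈ X⁻¹O` of `f ∈ K̂`. -/
def fracPart (f : Khat k) : Khat k := f - intPart f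

/-- The Artin map `Ψ(f) = 1/f - [1/f]`. -/
def ArtinPsi (f : Khat k) : Khat k := fracPart f⁻¹

/-- The Artin continued fraction digit `a_{n+1}(f) = [1/Ψⁿ(f)]` (for `n : ℕ`, so that
`digit 0 f = a₁(f) = [1/f]`). -/
def digit (n : ℕ) (f : Khat k) : Khat k := intPart ((ArtinPsi (k := k))^[n] f)⁻¹

variable (k)

/-- The set `J = ⋃_{a ∈ A∖k} (a + X⁻¹O)`. -/
def Jset : Set (Khat k) := ⋃ a ∈ AmK k, (fun x => a + x) '' XinvO k

/-- The domain `Ω = (J ∩ ᶜK) × (X⁻¹O ∩ ᶜK)` of the natural extension of the Artin map. -/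
def OmegaSet : Set (Khat k × Khat k) := (Jset k ∩ cK k) ×ˢ (XinvO k ∩ cK k)

variable {k}

/-- The map `Φ(ξ₋, ξ₊) = (1/ξ₋ - [1/ξ₊], Ψ(ξ₊))` (as a globally defined map on `K̂ × K̂`). -/
def PhiRaw (p : Khat k × Khat k) : Khat k × Khat k :=
  (p.1⁻¹ - intPart p.2⁻¹, ArtinPsi p.2)

/-- The coding map `Θ'` sending `(ξ₋, ξ₊)` to the bilateral sequence `(c_n)_{n ∈ ℤ}` with
`c_n = a_n(ξ₊)` for `n ≥ 1` and `c_{-n} = a_{n+1}(-1/ξ₋)` for `n ≥ 0`. -/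
def ThetaRaw (p : Khat k × Khat k) : ℤ → Khat k := fun n =>
  if 1 ≤ n then digit (n - 1).toNat p.2 else digit (-n).toNat (-p.1⁻¹)

variable (k)

/-- The density `q²/|ξ₊ - ξ₋|²_∞`. -/
def dens (p : Khat k × Khat k) : ℝ≥0∞ :=
  ENNReal.ofReal ((Fintype.card k : ℝ) ^ 2 * ((absInf (p.2 - p.1)) ^ 2)⁻¹)

/-- The measure `m̂` on `Ω` given by `dm̂(ξ₋,ξ₊) = q² dμ(ξ₋) dμ(ξ₊)/|ξ₊ - ξ₋|²_∞`. -/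
def mhat (μ : Measure (Khat k)) : Measure (Khat k × Khat k) :=
  (((μ.prod μ).withDensity (dens k))).restrict (OmegaSet k)

/-- The weight `ν(a) = |a|_∞⁻² = q^{-2 deg a}` for `a ∈ A∖k` (and `0` otherwise),
with values in `ℝ≥0∞`. -/
def nuE (a : Khat k) : ℝ≥0∞ :=
  if a ∈ AmK k then ENNReal.ofReal (((absInf a) ^ 2)⁻¹) else 0

section Homography

variable {k}

lemma one_lt_card : (1 : ℝ) < Fintype.card k := by
  exact_mod_cast Fintype.one_lt_card

lemma absInf_mul (f g : Khat k) : absInf (f * g) = absInf f * absInf g := by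
  rcases eq_or_ne f 0 with rfl | hf
  · simp [absInf]
  rcases eq_or_ne g 0 with rfl | hg
  · simp [absInf]
  have hq : (Fintype.card k : ℝ) ≠ 0 := by positivity
  rw [absInf, absInf, absInf, if_neg hf, if_neg hg, if_neg (mul_ne_zero hf hg),
    HahnSeries.order_mul hf hg, neg_add, zpow_add₀ hq]

instance : NormedField (Khat k) :=
  { (inferInstance : Field (Khat k)), (inferInstance : MetricSpace (Khat k)) with
    norm := absInf
    dist_eq := fun f g => by
      rw [dist_comm, neg_add_eq_sub]
      rfl
    norm_mul := absInf_mul }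

instance : IsUltrametricDist (Khat k) :=
  IsUltrametricDist.isUltrametricDist_of_forall_norm_add_le_max_norm absInf_add_le

lemma absInf_eq_norm (f : Khat k) : absInf f = ‖f‖ := rfl

lemma norm_eq_zpow {f : Khat k} (hf : f ≠ 0) : ‖f‖ = (Fintype.card k : ℝ) ^ (-f.order) :=
  if_neg hf

lemma norm_le_zpow_iff {f : Khat k} {n : ℤ} :
    ‖f‖ ≤ (Fintype.card k : ℝ) ^ n ↔ ∀ i < -n, f.coeff i = 0 := by
  rcases eq_or_ne f 0 with rfl | hf
  · simp [zpow_nonneg]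
  · rw [norm_eq_zpow hf, zpow_le_zpow_iff_right₀ one_lt_card, ← HahnSeries.le_order_iff_forall hf,
      neg_le]

lemma exists_zpow_lt {ε : ℝ} (hε : 0 < ε) : ∃ n : ℤ, (Fintype.card k : ℝ) ^ n < ε := by
  obtain ⟨n, hn⟩ := exists_pow_lt_of_lt_one hε (inv_lt_one_of_one_lt₀ (one_lt_card (k := k)))
  exact ⟨-n, by simpa using hn⟩

instance : TopologicalSpace.SeparableSpace (Khat k) := by
  refine ⟨Set.range (HahnSeries.ofFinsupp : (ℤ →₀ k) → Khat k), Set.countable_range _, ?_⟩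
  refine Metric.dense_iff.mpr fun f ε hε => ?_
  obtain ⟨n, hn⟩ := exists_zpow_lt (k := k) hε
  let g : ℤ →₀ k := Finsupp.onFinset (Finset.Ico f.order (-n))
    (fun i => if i < -n then f.coeff i else 0) fun i hi => by
      simp only [ne_eq, ite_eq_right_iff, Classical.not_imp] at hi
      exact Finset.mem_Ico.mpr ⟨not_lt.mp fun h => hi.2 (HahnSeries.coeff_eq_zero_of_lt_order h),
        hi.1⟩
  refine ⟨HahnSeries.ofFinsupp g, ?_, g, rfl⟩
  rw [Metric.mem_ball, dist_eq_norm]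
  refine lt_of_le_of_lt (norm_le_zpow_iff.mpr fun i hi => ?_) hn
  simp [g, hi]

instance : SecondCountableTopology (Khat k) := UniformSpace.secondCountable_of_separable _

/-- The closed balls of `K̂` whose radius is an integral power of `q`. -/
def balls (k : Type*) [Field k] [Fintype k] : Set (Set (Khat k)) :=
  Set.range fun p : Khat k × ℤ => Metric.closedBall p.1 ((Fintype.card k : ℝ) ^ p.2)

lemma zpow_card_ne_zero (n : ℤ) : (Fintype.card k : ℝ) ^ n ≠ 0 := by positivity

lemma countable_balls : (balls k).Countable := by
  refine (((TopologicalSpace.exists_countable_dense (Khat k)).choose_spec.1.prod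
    (Set.countable_univ (α := ℤ))).image fun p =>
      Metric.closedBall p.1 ((Fintype.card k : ℝ) ^ p.2)).mono ?_
  rintro _ ⟨⟨x, n⟩, rfl⟩
  have hd := (TopologicalSpace.exists_countable_dense (Khat k)).choose_spec.2
  obtain ⟨y, hy, hyx⟩ := hd.exists_dist_lt x (ε := (Fintype.card k : ℝ) ^ n) (by positivity)
  refine ⟨(y, n), ⟨hy, trivial⟩, ?_⟩
  exact IsUltrametricDist.closedBall_eq_of_mem (by simpa using hyx.le)

lemma isTopologicalBasis_balls : TopologicalSpace.IsTopologicalBasis (balls k) := by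
  refine TopologicalSpace.isTopologicalBasis_of_isOpen_of_nhds ?_ fun x U hx hU => ?_
  · rintro _ ⟨⟨x, n⟩, rfl⟩
    exact IsUltrametricDist.isOpen_closedBall x (zpow_card_ne_zero n)
  · obtain ⟨ε, hε, h⟩ := Metric.isOpen_iff.mp hU x hx
    obtain ⟨n, hn⟩ := exists_zpow_lt (k := k) hε
    exact ⟨_, ⟨(x, n), rfl⟩, Metric.mem_closedBall_self (by positivity),
      (Metric.closedBall_subset_ball hn).trans h⟩

lemma balls_trichotomy {s t : Set (Khat k)} (hs : s ∈ balls k) (ht : t ∈ balls k) :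
    s ∩ t = s ∨ s ∩ t = t ∨ s ∩ t = ∅ := by
  obtain ⟨⟨x, m⟩, rfl⟩ := hs
  obtain ⟨⟨y, n⟩, rfl⟩ := ht
  rw [Set.inter_eq_left, Set.inter_eq_right, ← Set.disjoint_iff_inter_eq_empty]
  exact IsUltrametricDist.closedBall_subset_trichotomy (X := Khat k) _ _ _ _

/-- Two measures coincide as soon as they have the same finite values on the balls contained in an
open set with null complement. -/
lemma measure_ext_of_balls {μ ν : Measure (Khat k)} {S : Set (Khat k)} (hS : IsOpen S)
    (hμ : μ Sᶜ = 0) (hν : ν Sᶜ = 0) (hfin : ∀ B ∈ balls k, B ⊆ S → μ B ≠ ∞)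
    (h : ∀ B ∈ balls k, B ⊆ S → μ B = ν B) : μ = ν := by
  refine Measure.ext_of_generateFrom_of_cover (S := balls k)
    (T := insert Sᶜ {B | B ∈ balls k ∧ B ⊆ S}) ?_ ?_ ?_ ?_ ?_ ?_ ?_
  · rw [← isTopologicalBasis_balls.borel_eq_generateFrom]
    rfl
  · exact (countable_balls.mono fun B hB => hB.1).insert _
  · intro s hs t ht hst
    rcases balls_trichotomy hs ht with h | h | h
    · rwa [h]
    · rwa [h]
    · exact absurd h hst.ne_empty
  · refine Set.eq_univ_of_forall fun x => ?_
    by_cases hx : x ∈ S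
    · obtain ⟨B, hB, hxB, hBS⟩ := isTopologicalBasis_balls.exists_subset_of_mem_open hx hS
      exact ⟨B, Or.inr ⟨hB, hBS⟩, hxB⟩
    · exact ⟨Sᶜ, Or.inl rfl, hx⟩
  · rintro t (rfl | ⟨ht, htS⟩)
    · simp [hμ]
    · exact hfin t ht htS
  · rintro t (rfl | ⟨ht, htS⟩) s hs
    · rw [measure_mono_null Set.inter_subset_right hμ, measure_mono_null Set.inter_subset_right hν]
    · rcases balls_trichotomy hs ht with h' | h' | h'
      · rw [h']
        exact h s hs ((Set.inter_eq_left.mp h').trans htS)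
      · rw [h']
        exact h t ht htS
      · simp [h']
  · rintro t (rfl | ⟨ht, htS⟩)
    · rw [hμ, hν]
    · exact h t ht htS

section Haar

variable {μ : Measure (Khat k)}

lemma measure_closedBall_eq (hinv : ∀ x : Khat k, μ.map (fun y => x + y) = μ) (x : Khat k)
    (r : ℝ) : μ (Metric.closedBall x r) = μ (Metric.closedBall 0 r) := by
  conv_lhs => rw [← hinv x]
  rw [Measure.map_apply (by fun_prop) Metric.isClosed_closedBall.measurableSet]
  congr 1
  ext y
  simp [dist_eq_norm]

lemma closedBall_zpow_succ (n : ℤ) :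
    Metric.closedBall (0 : Khat k) ((Fintype.card k : ℝ) ^ (n + 1)) =
      ⋃ c : k, Metric.closedBall (HahnSeries.single (-(n + 1)) c : Khat k)
        ((Fintype.card k : ℝ) ^ n) := by
  ext f
  simp only [Set.mem_iUnion, Metric.mem_closedBall, dist_eq_norm, sub_zero, norm_le_zpow_iff,
    HahnSeries.coeff_sub]
  constructor
  · intro h
    refine ⟨f.coeff (-(n + 1)), fun i hi => ?_⟩
    rcases eq_or_ne i (-(n + 1)) with rfl | hne
    · simp
    · rw [HahnSeries.coeff_single_of_ne hne, sub_zero, h i (by omega)]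
  · rintro ⟨c, hc⟩ i hi
    simpa only [HahnSeries.coeff_single_of_ne hi.ne, sub_zero] using hc i (by omega)

lemma pairwise_disjoint_closedBall_single (n : ℤ) :
    Pairwise (Function.onFun Disjoint fun c : k =>
      Metric.closedBall (HahnSeries.single (-(n + 1)) c : Khat k) ((Fintype.card k : ℝ) ^ n)) := by
  intro c e hce
  refine Set.disjoint_left.mpr fun f hc he => hce ?_
  simp only [Metric.mem_closedBall, dist_eq_norm, norm_le_zpow_iff, HahnSeries.coeff_sub] at hc he
  have h1 := hc (-(n + 1)) (by omega)
  have h2 := he (-(n + 1)) (by omega)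
  rw [HahnSeries.coeff_single_same, sub_eq_zero] at h1 h2
  exact h1.symm.trans h2

lemma measure_closedBall_zpow (hinv : ∀ x : Khat k, μ.map (fun y => x + y) = μ)
    (hO : μ (Oball k) = 1) (x : Khat k) (n : ℤ) :
    μ (Metric.closedBall x ((Fintype.card k : ℝ) ^ n)) =
      ENNReal.ofReal ((Fintype.card k : ℝ) ^ n) := by
  rw [measure_closedBall_eq hinv]
  have hq : (Fintype.card k : ℝ) ≠ 0 := by positivity
  have hsucc (n : ℤ) : μ (Metric.closedBall 0 ((Fintype.card k : ℝ) ^ (n + 1))) =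
      Fintype.card k * μ (Metric.closedBall 0 ((Fintype.card k : ℝ) ^ n)) := by
    rw [closedBall_zpow_succ, measure_iUnion (pairwise_disjoint_closedBall_single n)
      fun _ => Metric.isClosed_closedBall.measurableSet]
    simp [measure_closedBall_eq hinv _ ((Fintype.card k : ℝ) ^ n), tsum_fintype]
  have hcard (n : ℤ) : ENNReal.ofReal ((Fintype.card k : ℝ) ^ (n + 1)) =
      Fintype.card k * ENNReal.ofReal ((Fintype.card k : ℝ) ^ n) := by
    rw [zpow_add_one₀ hq, mul_comm, ENNReal.ofReal_mul (by positivity), ENNReal.ofReal_natCast]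
  induction n using Int.induction_on with
  | zero =>
    rw [zpow_zero, ENNReal.ofReal_one, ← hO]
    congr 1
    ext f
    simp [Oball, absInf_eq_norm]
  | succ n ih => rw [hsucc, hcard, ih]
  | pred n ih =>
    have h1 := hsucc (-n - 1)
    have h2 := hcard (-n - 1)
    rw [sub_add_cancel] at h1 h2
    rw [h1, h2] at ih
    exact (ENNReal.mul_right_inj (by simp) (ENNReal.natCast_ne_top _)).mp ih

lemma measure_singleton_eq_zero (hinv : ∀ x : Khat k, μ.map (fun y => x + y) = μ)
    (hO : μ (Oball k) = 1) (x : Khat k) : μ {x} = 0 := by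
  refine le_antisymm (ENNReal.le_of_forall_pos_le_add fun ε hε _ => ?_) zero_le
  obtain ⟨n, hn⟩ := exists_zpow_lt (k := k) (NNReal.coe_pos.mpr hε)
  calc μ {x} ≤ μ (Metric.closedBall x ((Fintype.card k : ℝ) ^ n)) :=
        measure_mono (Set.singleton_subset_iff.mpr (Metric.mem_closedBall_self (by positivity)))
    _ ≤ ENNReal.ofReal ε := by
        rw [measure_closedBall_zpow hinv hO]
        exact ENNReal.ofReal_le_ofReal hn.le
    _ = 0 + ε := by simp

lemma sigmaFinite_of_map_add_eq (hinv : ∀ x : Khat k, μ.map (fun y => x + y) = μ)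
    (hO : μ (Oball k) = 1) : SigmaFinite μ := by
  have : IsLocallyFiniteMeasure μ := ⟨fun x =>
    ⟨Metric.closedBall x ((Fintype.card k : ℝ) ^ (0 : ℤ)),
      Metric.closedBall_mem_nhds x (by positivity),
      by rw [measure_closedBall_zpow hinv hO]; exact ENNReal.ofReal_lt_top⟩⟩
  infer_instance

end Haar

section Mobius

section Field

variable {F : Type*} [Field F] {a b c d : F}

lemma mul_mobius_inv_add {z : F} (hz : a - c * z ≠ 0) :
    c * ((d * z - b) / (a - c * z)) + d = (a * d - b * c) / (a - c * z) := by
  rw [eq_div_iff hz, add_mul, mul_assoc, div_mul_cancel₀ _ hz]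
  ring

lemma mobius_mobius_inv (hdet : a * d - b * c ≠ 0) {z : F} (hz : a - c * z ≠ 0) :
    (a * ((d * z - b) / (a - c * z)) + b) / (c * ((d * z - b) / (a - c * z)) + d) = z := by
  rw [mul_mobius_inv_add hz, div_eq_iff (div_ne_zero hdet hz), mul_div_assoc', mul_div_assoc',
    div_add' _ _ _ hz]
  congr 1
  ring

lemma sub_mobius {y : F} (hy : c * y + d ≠ 0) :
    a - c * ((a * y + b) / (c * y + d)) = (a * d - b * c) / (c * y + d) := by
  rw [eq_div_iff hy, sub_mul, mul_assoc, div_mul_cancel₀ _ hy]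
  ring

lemma mobius_sub_mobius {x y : F} (hx : c * x + d ≠ 0) (hy : c * y + d ≠ 0) :
    (a * x + b) / (c * x + d) - (a * y + b) / (c * y + d) =
      (a * d - b * c) * (x - y) / ((c * x + d) * (c * y + d)) := by
  rw [div_sub_div _ _ hx hy]
  congr 1
  ring

end Field

variable {a b c d : Khat k}

lemma norm_mul_add_eq_of_norm_sub_lt {x y : Khat k} (h : ‖c * (y - x)‖ < ‖c * x + d‖) :
    ‖c * y + d‖ = ‖c * x + d‖ := by
  rw [show c * y + d = c * (y - x) + (c * x + d) by ring]
  rw [IsUltrametricDist.norm_add_eq_max_of_norm_ne_norm h.ne, max_eq_right h.le]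

/-- The preimage by a homography of a ball which does not contain the image of `∞`
is, away from the pole, a ball. -/
lemma mobius_preimage_closedBall (hdet : ‖a * d - b * c‖ = 1) {x : Khat k} {r : ℝ} (hr : 0 < r)
    (hx : ∀ z ∈ Metric.closedBall x r, a - c * z ≠ 0) :
    {y | c * y + d ≠ 0 ∧ (a * y + b) / (c * y + d) ∈ Metric.closedBall x r} =
        Metric.closedBall ((d * x - b) / (a - c * x)) (r / ‖a - c * x‖ ^ 2) ∧
      ∀ y ∈ Metric.closedBall ((d * x - b) / (a - c * x)) (r / ‖a - c * x‖ ^ 2),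
        ‖c * y + d‖ = ‖a - c * x‖⁻¹ := by
  have hdet0 : a * d - b * c ≠ 0 := norm_ne_zero_iff.mp (by simp [hdet])
  have hx0 := hx x (Metric.mem_closedBall_self hr.le)
  have hD : 0 < ‖a - c * x‖ := norm_pos_iff.mpr hx0
  have hcr : ‖c‖ * r < ‖a - c * x‖ := by
    rcases eq_or_ne c 0 with rfl | hc
    · simpa using hD
    · by_contra! hle
      refine hx (a / c) ?_ (by field_simp; ring)
      have : a / c - x = (a - c * x) / c := by field_simp
      rw [Metric.mem_closedBall, dist_eq_norm, this, norm_div, div_le_iff₀ (norm_pos_iff.mpr hc)]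
      linarith
  have h1 := mul_mobius_inv_add (b := b) (d := d) hx0
  have h2 := mobius_mobius_inv hdet0 hx0
  set y₀ := (d * x - b) / (a - c * x)
  have hy₀ : ‖c * y₀ + d‖ = ‖a - c * x‖⁻¹ := by rw [h1, norm_div, hdet, one_div]
  have hnorm : ∀ y ∈ Metric.closedBall y₀ (r / ‖a - c * x‖ ^ 2),
      ‖c * y + d‖ = ‖a - c * x‖⁻¹ := by
    intro y hy
    rw [Metric.mem_closedBall, dist_eq_norm] at hy
    rw [← hy₀]
    refine norm_mul_add_eq_of_norm_sub_lt ?_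
    calc ‖c * (y - y₀)‖ ≤ ‖c‖ * (r / ‖a - c * x‖ ^ 2) := by
          rw [norm_mul]
          gcongr
      _ = ‖c‖ * r / ‖a - c * x‖ ^ 2 := by ring
      _ < ‖a - c * x‖ / ‖a - c * x‖ ^ 2 := by gcongr
      _ = ‖c * y₀ + d‖ := by
          rw [hy₀]
          field_simp
  have hy₀0 : c * y₀ + d ≠ 0 := norm_pos_iff.mp (by rw [hy₀]; positivity)
  have hdist {y : Khat k} (hy0 : c * y + d ≠ 0) (hy : ‖c * y + d‖ = ‖a - c * x‖⁻¹) :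
      (a * y + b) / (c * y + d) ∈ Metric.closedBall x r ↔
        y ∈ Metric.closedBall y₀ (r / ‖a - c * x‖ ^ 2) := by
    rw [Metric.mem_closedBall, Metric.mem_closedBall, dist_eq_norm, dist_eq_norm]
    nth_rw 1 [← h2]
    rw [mobius_sub_mobius hy0 hy₀0, norm_div, norm_mul, norm_mul, hdet, hy, hy₀,
      le_div_iff₀ (by positivity), one_mul, ← mul_inv, div_inv_eq_mul, sq]
  refine ⟨Set.ext fun y => ⟨?_, fun hy => ?_⟩, hnorm⟩
  · rintro ⟨hy0, hy⟩
    refine (hdist hy0 ?_).mp hy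
    have hz : ‖c * ((a * y + b) / (c * y + d) - x)‖ < ‖-c * x + a‖ := by
      rw [Metric.mem_closedBall, dist_eq_norm] at hy
      rw [norm_mul, neg_mul, neg_add_eq_sub]
      exact (mul_le_mul_of_nonneg_left hy (norm_nonneg c)).trans_lt hcr
    have := norm_mul_add_eq_of_norm_sub_lt (c := -c) (by rwa [neg_mul, norm_neg])
    rw [neg_mul, neg_mul, neg_add_eq_sub, neg_add_eq_sub, sub_mobius hy0, norm_div, hdet,
      one_div] at this
    rw [← this, inv_inv]
  · have hy0 : c * y + d ≠ 0 := norm_pos_iff.mp (by rw [hnorm y hy]; positivity)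
    exact ⟨hy0, (hdist hy0 (hnorm y hy)).mpr hy⟩

variable {μ : Measure (Khat k)}

lemma ae_mul_add_ne_zero (hinv : ∀ x : Khat k, μ.map (fun y => x + y) = μ)
    (hO : μ (Oball k) = 1) (hcd : c ≠ 0 ∨ d ≠ 0) : ∀ᵐ y ∂μ, c * y + d ≠ 0 := by
  have : {y : Khat k | ¬ c * y + d ≠ 0} ⊆ {-d / c} := by
    intro y hy
    simp only [ne_eq, not_not, Set.mem_ofPred_eq] at hy
    have hc : c ≠ 0 := by
      rintro rfl
      simp_all
    rw [Set.mem_singleton_iff, eq_div_iff hc]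
    linear_combination hy
  exact measure_mono_null this (measure_singleton_eq_zero hinv hO _)

/-- Change of variables formula for homographies of determinant of absolute value `1`. -/
lemma map_mobius_withDensity (hinv : ∀ x : Khat k, μ.map (fun y => x + y) = μ)
    (hO : μ (Oball k) = 1) (hdet : ‖a * d - b * c‖ = 1) :
    (μ.withDensity fun y => ENNReal.ofReal ((‖c * y + d‖ ^ 2)⁻¹)).map
      (fun y => (a * y + b) / (c * y + d)) = μ := by
  have hdet0 : a * d - b * c ≠ 0 := norm_ne_zero_iff.mp (by simp [hdet])
  have hγ : Measurable fun y : Khat k => (a * y + b) / (c * y + d) := by fun_prop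
  have hcd : ∀ᵐ y ∂μ, c * y + d ≠ 0 := ae_mul_add_ne_zero hinv hO <| by
    by_contra! h
    simp [h] at hdet
  have hac : ∀ᵐ y ∂μ, -c * y + a ≠ 0 := ae_mul_add_ne_zero hinv hO <| by
    by_contra! h
    simp [neg_eq_zero.mp h.1, h.2] at hdet
  set ν := μ.withDensity fun y => ENNReal.ofReal ((‖c * y + d‖ ^ 2)⁻¹)
  have hν : ∀ᵐ y ∂ν, c * y + d ≠ 0 := (withDensity_absolutelyContinuous _ _).ae_le hcd
  have hcont : Continuous fun z : Khat k => a - c * z := by fun_prop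
  have hS : IsOpen {z : Khat k | a - c * z ≠ 0} := isOpen_ne_fun hcont continuous_const
  have key : ∀ B ∈ balls k, B ⊆ {z : Khat k | a - c * z ≠ 0} →
      ν.map (fun y => (a * y + b) / (c * y + d)) B = μ B ∧ μ B ≠ ∞ := by
    rintro _ ⟨⟨x, n⟩, rfl⟩ hB
    have hx0 : a - c * x ≠ 0 := hB (Metric.mem_closedBall_self (by positivity))
    obtain ⟨hpre, hnorm⟩ := mobius_preimage_closedBall hdet (by positivity) hB
    refine ⟨?_, by simp [measure_closedBall_zpow hinv hO]⟩
    have hae : ((fun y => (a * y + b) / (c * y + d)) ⁻¹'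
        Metric.closedBall x ((Fintype.card k : ℝ) ^ n)) =ᵐ[ν]
        Metric.closedBall ((d * x - b) / (a - c * x))
          ((Fintype.card k : ℝ) ^ n / ‖a - c * x‖ ^ 2) := by
      rw [← hpre]
      filter_upwards [hν] with y hy
      exact propext ⟨fun h => ⟨hy, h⟩, fun h => h.2⟩
    rw [Measure.map_apply hγ Metric.isClosed_closedBall.measurableSet, measure_congr hae,
      withDensity_apply _ Metric.isClosed_closedBall.measurableSet,
      setLIntegral_congr_fun Metric.isClosed_closedBall.measurableSet
        (g := fun _ => ENNReal.ofReal (‖a - c * x‖ ^ 2))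
        fun y hy => by simp only [hnorm y hy, inv_pow, inv_inv],
      setLIntegral_const, norm_eq_zpow hx0, ← zpow_natCast, ← zpow_mul,
      ← zpow_sub₀ (by positivity), measure_closedBall_zpow hinv hO, measure_closedBall_zpow hinv hO,
      ← ENNReal.ofReal_mul (by positivity), ← zpow_add₀ (by positivity)]
    congr 2
    ring
  refine measure_ext_of_balls hS ?_ ?_ (fun B hB hBS => ?_) fun B hB hBS => (key B hB hBS).1
  · rw [Measure.map_apply hγ hS.measurableSet.compl]
    refine measure_eq_zero_iff_ae_notMem.mpr ?_
    filter_upwards [hν] with y hy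
    simpa [sub_mobius hy] using ⟨hdet0, hy⟩
  · refine measure_eq_zero_iff_ae_notMem.mpr ?_
    filter_upwards [hac] with y hy
    simpa [neg_add_eq_sub] using hy
  · rw [(key B hB hBS).1]
    exact (key B hB hBS).2

/-- Pushforward commutes with densities. -/
lemma map_withDensity_comp {α β : Type*} [MeasurableSpace α] [MeasurableSpace β] {ν : Measure α}
    {f : α → β} {g : β → ℝ≥0∞} (hf : Measurable f) (hg : Measurable g) :
    (ν.withDensity fun x => g (f x)).map f = (ν.map f).withDensity g := by
  ext s hs
  rw [Measure.map_apply hf hs, withDensity_apply _ (hf hs), withDensity_apply _ hs,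
    setLIntegral_map hs hg hf]

lemma map_mobius_prod_withDensity (hinv : ∀ x : Khat k, μ.map (fun y => x + y) = μ)
    (hO : μ (Oball k) = 1) (hdet : ‖a * d - b * c‖ = 1) :
    ((μ.prod μ).withDensity fun p => ENNReal.ofReal ((‖p.2 - p.1‖ ^ 2)⁻¹)).map
        (fun p : Khat k × Khat k =>
          ((a * p.1 + b) / (c * p.1 + d), (a * p.2 + b) / (c * p.2 + d))) =
      (μ.prod μ).withDensity fun p => ENNReal.ofReal ((‖p.2 - p.1‖ ^ 2)⁻¹) := by
  have := sigmaFinite_of_map_add_eq hinv hO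
  have hcd : ∀ᵐ y ∂μ, c * y + d ≠ 0 := ae_mul_add_ne_zero hinv hO <| by
    by_contra! h
    simp [h] at hdet
  have hγ : Measurable fun y : Khat k => (a * y + b) / (c * y + d) := by fun_prop
  have hw : Measurable fun y : Khat k => ENNReal.ofReal ((‖c * y + d‖ ^ 2)⁻¹) := by fun_prop
  have hD : Measurable fun p : Khat k × Khat k => ENNReal.ofReal ((‖p.2 - p.1‖ ^ 2)⁻¹) := by
    fun_prop
  have hmap := map_mobius_withDensity hinv hO hdet
  set γ := fun y : Khat k => (a * y + b) / (c * y + d)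
  have hprod := Measure.map_prod_map (μ.withDensity fun y => ENNReal.ofReal ((‖c * y + d‖ ^ 2)⁻¹))
    (μ.withDensity fun y => ENNReal.ofReal ((‖c * y + d‖ ^ 2)⁻¹)) hγ hγ
  rw [hmap, prod_withDensity hw hw] at hprod
  nth_rw 2 [hprod]
  rw [← map_withDensity_comp (hγ.prodMap hγ) hD,
    ← withDensity_mul _ (by fun_prop) (by fun_prop)]
  refine congrArg (Measure.map (Prod.map γ γ)) (withDensity_congr_ae ?_)
  filter_upwards [Measure.quasiMeasurePreserving_fst.ae hcd,
    Measure.quasiMeasurePreserving_snd.ae hcd] with p h1 h2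
  have hn1 : ‖c * p.1 + d‖ ≠ 0 := norm_ne_zero_iff.mpr h1
  have hn2 : ‖c * p.2 + d‖ ≠ 0 := norm_ne_zero_iff.mpr h2
  simp only [Pi.mul_apply, Prod.map, γ]
  rw [mobius_sub_mobius h2 h1, norm_div, norm_mul, norm_mul, hdet,
    ← ENNReal.ofReal_mul (by positivity), ← ENNReal.ofReal_mul (by positivity)]
  congr 1
  generalize ‖c * p.1 + d‖ = u at *
  generalize ‖c * p.2 + d‖ = v at *
  field_simp

end Mobius

lemma absInf_eq_one_of_mem_kconsts {f : Khat k} (hf : f ∈ kconsts k) (h0 : f ≠ 0) :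
    absInf f = 1 := by
  obtain ⟨r, rfl⟩ := hf
  rw [absInf, if_neg h0, HahnSeries.algebraMap_apply', ← PowerSeries.C_eq_algebraMap,
    HahnSeries.ofPowerSeries_C, HahnSeries.order_C, neg_zero, zpow_zero]

end Homography

/-- The measure `dM(ξ₋,ξ₊) = dμ(ξ₋)dμ(ξ₊)/|ξ₊ - ξ₋|²` is invariant under the
diagonal action of homographies of determinant of absolute value `1`; in particular under the
diagonal action of `GL₂(A)`-matrices with determinant in `k∖{0}`. -/
theorem statement_7 (k : Type*) [Field k] [Fintype k] (μ : MeasureTheory.Measure (Khat k))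
    (hinv : ∀ x : Khat k, MeasureTheory.Measure.map (fun y => x + y) μ = μ)
    (hO : μ (Oball k) = 1) :
    (∀ a b c d : Khat k, absInf (a * d - b * c) = 1 →
      MeasureTheory.Measure.map
          (fun p : Khat k × Khat k =>
            ((a * p.1 + b) / (c * p.1 + d), (a * p.2 + b) / (c * p.2 + d)))
          ((μ.prod μ).withDensity fun p => ENNReal.ofReal (((absInf (p.2 - p.1)) ^ 2)⁻¹))
        = (μ.prod μ).withDensity fun p => ENNReal.ofReal (((absInf (p.2 - p.1)) ^ 2)⁻¹)) ∧
    (∀ a b c d : Khat k, a ∈ Aset k → b ∈ Aset k → c ∈ Aset k → d ∈ Aset k →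
      a * d - b * c ∈ kconsts k → a * d - b * c ≠ 0 →
      MeasureTheory.Measure.map
          (fun p : Khat k × Khat k =>
            ((a * p.1 + b) / (c * p.1 + d), (a * p.2 + b) / (c * p.2 + d)))
          ((μ.prod μ).withDensity fun p => ENNReal.ofReal (((absInf (p.2 - p.1)) ^ 2)⁻¹))
        = (μ.prod μ).withDensity fun p => ENNReal.ofReal (((absInf (p.2 - p.1)) ^ 2)⁻¹)) := by
  refine ⟨fun a b c d hdet => map_mobius_prod_withDensity hinv hO hdet,
    fun a b c d _ _ _ _ hk h0 => ?_⟩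
  exact map_mobius_prod_withDensity hinv hO (absInf_eq_one_of_mem_kconsts hk h0)

end ArtinCoding
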